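/- In the warden's game with n dice each having m sides (m ≥ 1, n ≥ 1), positions of consecutive remoteness overlap: if β and γ are positions with r(β) = r(γ) + 1, then the first n−1 coordinates of β equal the last n−1 coordinates of γ; that is, γ_{j+1} = β_j for all j ∈ {0, …, n−2}. -/

import Mathlib

/-- One move: the rightmost entry is transferred to the far left, becoming `c`,
producing `(c, x₀, …, x_{n−2})`. -/
def shift {α : Type*} {n : ℕ} (c : α) (x : Fin n → α) : Fin n → α :=
  fun i => if _h : (i : ℕ) = 0 then c
    else x ⟨(i : ℕ) - 1, lt_of_le_of_lt (Nat.sub_le _ _) i.isLt⟩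

/-- The goal position: every die shows `m - 1`. -/
def goalPos (m n : ℕ) (hm : 1 ≤ m) : Fin n → Fin m :=
  fun _ => ⟨m - 1, Nat.sub_lt hm Nat.one_pos⟩

/-- `CanWin m n hm hn N x`: the prisoner can force the goal within `N` moves from
position `x`.  It holds iff `x` is the goal, or `N ≥ 1` and both:
(i) for every warden choice `c < x_{n-1}`, `CanWin (N-1)` holds at `(c, x₀, …, x_{n−2})`, and
(ii) there is a prisoner choice `c ≥ x_{n-1}` with `CanWin (N-1)` at `(c, x₀, …, x_{n−2})`. -/
def CanWin (m n : ℕ) (hm : 1 ≤ m) (hn : 1 ≤ n) : ℕ → (Fin n → Fin m) → Prop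
  | 0, x => x = goalPos m n hm
  | N + 1, x => x = goalPos m n hm ∨
      ((∀ c : Fin m, c < x ⟨n - 1, Nat.sub_lt hn Nat.one_pos⟩ →
          CanWin m n hm hn N (shift c x)) ∧
       ∃ c : Fin m, x ⟨n - 1, Nat.sub_lt hn Nat.one_pos⟩ ≤ c ∧
          CanWin m n hm hn N (shift c x))

/-- The remoteness of a position: the least `N` with `CanWin N x`. -/
noncomputable def remoteness (m n : ℕ) (hm : 1 ≤ m) (hn : 1 ≤ n)
    (x : Fin n → Fin m) : ℕ :=
  sInf {N | CanWin m n hm hn N x}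

open Finset in
/-- If `C` is downward closed away from `t = max`, then the values `d` all of whose predecessors
lie in `C` and which are dominated by an element of `C` are as numerous as `C`. -/
lemma card_filter_forall_lt_exists_le {α : Type*} [LinearOrder α] [Fintype α] (t : α)
    (ht : ∀ a, a ≤ t) (C : Finset α) (hC : ∀ a ∈ C, a ≠ t → ∀ b ≤ a, b ∈ C) :
    #{d | (∀ c < d, c ∈ C) ∧ ∃ c, d ≤ c ∧ c ∈ C} = #C := by
  classical
  by_cases htC : t ∈ C
  · by_cases hfull : ∀ a, a ∈ C
    · congr 1
      ext d
      simp only [mem_filter, mem_univ, true_and]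
      exact ⟨fun _ => hfull d, fun _ => ⟨fun c _ => hfull c, d, le_rfl, hfull d⟩⟩
    · push Not at hfull
      have hne : (Cᶜ).Nonempty := by
        obtain ⟨a, ha⟩ := hfull
        exact ⟨a, by simpa using ha⟩
      obtain ⟨s, hs, hmin⟩ : ∃ s, s ∉ C ∧ ∀ a, a ∉ C → s ≤ a :=
        ⟨Cᶜ.min' hne, by simpa using Cᶜ.min'_mem hne,
          fun a ha => Cᶜ.min'_le a (by simpa using ha)⟩
      have hlt : ∀ a ∈ C, a ≠ t → a < s := fun a ha hat =>
        lt_of_not_ge fun hsa => hs (hC a ha hat s hsa)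
      have hst : s < t := lt_of_le_of_ne (ht s) fun e => hs (e ▸ htC)
      have key : ({d | (∀ c < d, c ∈ C) ∧ ∃ c, d ≤ c ∧ c ∈ C} : Finset α)
          = insert s (C.erase t) := by
        ext d
        simp only [mem_filter, mem_univ, true_and, mem_insert, mem_erase]
        constructor
        · rintro ⟨h, -⟩
          have hds : d ≤ s := le_of_not_gt fun hsd => hs (h s hsd)
          rcases hds.eq_or_lt with e | hd
          · exact Or.inl e
          · refine Or.inr ⟨(hd.trans hst).ne, ?_⟩
            by_contra hdC
            exact absurd hd (not_lt.2 (hmin d hdC))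
        · intro h
          have hds : d ≤ s := by
            rcases h with rfl | ⟨hdt, hd⟩
            · exact le_rfl
            · exact (hlt d hd hdt).le
          refine ⟨fun c hc => ?_, t, ht d, htC⟩
          by_contra hcC
          exact absurd (hc.trans_le hds) (not_lt.2 (hmin c hcC))
      rw [key, card_insert_of_notMem (by simp [hs]), card_erase_add_one htC]
  · congr 1
    ext d
    simp only [mem_filter, mem_univ, true_and]
    have hnt : ∀ a ∈ C, a ≠ t := fun a ha e => htC (e ▸ ha)
    exact ⟨fun ⟨_, c, hdc, hc⟩ => hC c hc (hnt c hc) d hdc,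
      fun hd => ⟨fun c hc => hC d hd (hnt d hd) c hc.le, d, le_rfl, hd⟩⟩

lemma shift_eq_cons_init {α : Type*} {k : ℕ} (c : α) (x : Fin (k + 1) → α) :
    shift c x = Fin.cons c (Fin.init x : Fin k → α) := by
  funext i
  refine Fin.cases ?_ (fun j => ?_) i
  · simp [shift]
  · simp only [shift, Fin.val_succ, Fin.cons_succ, Fin.init]
    rw [dif_neg (Nat.succ_ne_zero _)]
    rfl

open Finset in
lemma card_filter_eq_sum_cons {α : Type*} [Fintype α] {k : ℕ} (P : (Fin (k + 1) → α) → Prop)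
    [DecidablePred P] :
    #{x | P x} = ∑ w : Fin k → α, #{c | P (Fin.cons c w)} := by
  classical
  rw [card_eq_sum_card_fiberwise (f := fun x => (Fin.tail x : Fin k → α)) (t := univ)
    (fun _ _ => by simp)]
  refine sum_congr rfl fun w _ => ?_
  refine card_nbij' (fun x => x 0) (fun c => Fin.cons c w) ?_ ?_ ?_ ?_
  · intro x hx
    simp only [coe_filter, mem_filter, mem_univ, true_and, Set.mem_ofPred_eq] at hx ⊢
    rw [← hx.2, Fin.cons_self_tail]
    exact hx.1
  · intro c hc
    simpa using hc
  · intro x hx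
    simp only [coe_filter, mem_filter, mem_univ, true_and, Set.mem_ofPred_eq] at hx
    rw [← hx.2]
    exact Fin.cons_self_tail x
  · intro c _
    simp

open Finset in
lemma card_filter_eq_sum_snoc {α : Type*} [Fintype α] {k : ℕ} (P : (Fin (k + 1) → α) → Prop)
    [DecidablePred P] :
    #{x | P x} = ∑ w : Fin k → α, #{d | P (Fin.snoc w d)} := by
  classical
  rw [card_eq_sum_card_fiberwise (f := fun x => (Fin.init x : Fin k → α)) (t := univ)
    (fun _ _ => by simp)]
  refine sum_congr rfl fun w _ => ?_
  refine card_nbij' (fun x => x (Fin.last k)) (fun c => Fin.snoc w c) ?_ ?_ ?_ ?_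
  · intro x hx
    simp only [coe_filter, mem_filter, mem_univ, true_and, Set.mem_ofPred_eq] at hx ⊢
    rw [← hx.2, Fin.snoc_init_self]
    exact hx.1
  · intro c hc
    simpa using hc
  · intro x hx
    simp only [coe_filter, mem_filter, mem_univ, true_and, Set.mem_ofPred_eq] at hx
    rw [← hx.2]
    exact Fin.snoc_init_self x
  · intro c _
    simp

/-- The prisoner can force `P` to hold after one move from `x`. -/
def CanForce {α : Type*} [LinearOrder α] {k : ℕ} (P : (Fin (k + 1) → α) → Prop)
    (x : Fin (k + 1) → α) : Prop :=
  (∀ c < x (Fin.last k), P (shift c x)) ∧ ∃ c, x (Fin.last k) ≤ c ∧ P (shift c x)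

/-- `P` is inherited by positions obtained by lowering dice that do not show `t`. -/
def IsLowerAwayFrom {α : Type*} [LinearOrder α] {k : ℕ} (t : α)
    (P : (Fin (k + 1) → α) → Prop) : Prop :=
  ∀ x y, P y → (∀ i, x i ≤ y i) → (∀ i, y i = t → x i = t) → P x

lemma IsLowerAwayFrom.canForce {α : Type*} [LinearOrder α] {k : ℕ} {t : α}
    {P : (Fin (k + 1) → α) → Prop} (hP : IsLowerAwayFrom t P) :
    IsLowerAwayFrom t (CanForce P) := by
  intro x y hy hle htop
  have mono : ∀ c, P (shift c y) → P (shift c x) := fun c hc => by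
    refine hP _ _ hc (fun i => ?_) fun i => ?_
    · unfold shift
      split
      · exact le_rfl
      · exact hle _
    · unfold shift
      split
      · exact id
      · exact htop _
  obtain ⟨h₁, c, hc, hPc⟩ := hy
  exact ⟨fun d hd => mono d (h₁ d (hd.trans_le (hle _))), c, (hle _).trans hc, mono c hPc⟩

open Finset in
lemma IsLowerAwayFrom.card_canForce {α : Type*} [LinearOrder α] [Fintype α] {k : ℕ} {t : α}
    (ht : ∀ a, a ≤ t) {P : (Fin (k + 1) → α) → Prop} [DecidablePred P]
    [DecidablePred (CanForce P)] (hP : IsLowerAwayFrom t P) :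
    #{x | CanForce P x} = #{x | P x} := by
  classical
  rw [card_filter_eq_sum_cons P, card_filter_eq_sum_snoc (CanForce P)]
  refine sum_congr rfl fun w _ => ?_
  rw [← card_filter_forall_lt_exists_le t ht {c | P (Fin.cons c w)}]
  · congr 1
    ext d
    simp [CanForce, shift_eq_cons_init]
  · intro a ha hat b hba
    simp only [mem_filter, mem_univ, true_and] at ha ⊢
    refine hP _ _ ha (fun i => ?_) fun i => ?_
    · refine Fin.cases ?_ (fun j => ?_) i <;> simp [hba]
    · refine Fin.cases ?_ (fun j => ?_) i <;> simp [hat]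

section CanWin

variable {m k : ℕ} {hm : 1 ≤ m} {hk : 1 ≤ k + 1}

lemma canWin_succ_iff {N : ℕ} {x : Fin (k + 1) → Fin m} :
    CanWin m (k + 1) hm hk (N + 1) x ↔
      x = goalPos m (k + 1) hm ∨ CanForce (CanWin m (k + 1) hm hk N) x :=
  Iff.rfl

lemma canWin_goalPos (N : ℕ) : CanWin m (k + 1) hm hk N (goalPos m (k + 1) hm) := by
  cases N with
  | zero => rfl
  | succ N => exact Or.inl rfl

lemma canWin_succ {N : ℕ} {x : Fin (k + 1) → Fin m} (h : CanWin m (k + 1) hm hk N x) :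
    CanWin m (k + 1) hm hk (N + 1) x := by
  induction N generalizing x with
  | zero => exact Or.inl h
  | succ N ih =>
    rcases h with h | ⟨h₁, c, hc, h₂⟩
    · exact Or.inl h
    · exact Or.inr ⟨fun d hd => ih (h₁ d hd), c, hc, ih h₂⟩

lemma canWin_mono {M N : ℕ} (hMN : M ≤ N) {x : Fin (k + 1) → Fin m}
    (h : CanWin m (k + 1) hm hk M x) : CanWin m (k + 1) hm hk N x := by
  induction hMN with
  | refl => exact h
  | step _ ih => exact canWin_succ ih

lemma le_goalPos_apply (i : Fin (k + 1)) (a : Fin m) : a ≤ goalPos m (k + 1) hm i :=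
  Fin.le_def.2 (Nat.le_sub_one_of_lt a.isLt)

lemma isLowerAwayFrom_canWin (N : ℕ) :
    IsLowerAwayFrom (goalPos m (k + 1) hm 0) (CanWin m (k + 1) hm hk N) := by
  have goal : ∀ x y : Fin (k + 1) → Fin m, y = goalPos m (k + 1) hm →
      (∀ i, y i = goalPos m (k + 1) hm 0 → x i = goalPos m (k + 1) hm 0) →
      x = goalPos m (k + 1) hm := by
    rintro x _ rfl h
    exact funext fun i => h i rfl
  induction N with
  | zero => exact fun x y hy _ h => goal x y hy h
  | succ N ih =>
    rintro x y (hy | hy) hle h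
    · exact Or.inl (goal x y hy h)
    · exact Or.inr (ih.canForce x y hy hle h)

open Finset Classical in
lemma card_canWin_succ_le (N : ℕ) :
    #{x | CanWin m (k + 1) hm hk (N + 1) x} ≤ #{x | CanWin m (k + 1) hm hk N x} + 1 := by
  rw [← (isLowerAwayFrom_canWin N).card_canForce (le_goalPos_apply 0)]
  refine (card_le_card fun x hx => ?_).trans (card_insert_le (goalPos m (k + 1) hm) _)
  simpa [canWin_succ_iff] using hx

open Finset Classical in
/-- At most one position has any given remoteness. -/
lemma eq_of_canWin_succ_of_not_canWin {N : ℕ} {x y : Fin (k + 1) → Fin m}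
    (hx : CanWin m (k + 1) hm hk (N + 1) x) (hx' : ¬ CanWin m (k + 1) hm hk N x)
    (hy : CanWin m (k + 1) hm hk (N + 1) y) (hy' : ¬ CanWin m (k + 1) hm hk N y) : x = y := by
  have hsub : univ.filter (CanWin m (k + 1) hm hk N) ⊆
      univ.filter (CanWin m (k + 1) hm hk (N + 1)) := fun z hz => by
    simp only [mem_filter, mem_univ, true_and] at hz ⊢
    exact canWin_succ hz
  have hcard := card_sdiff_add_card_eq_card hsub
  have hle : #(univ.filter (CanWin m (k + 1) hm hk (N + 1))) ≤
      #(univ.filter (CanWin m (k + 1) hm hk N)) + 1 := card_canWin_succ_le N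
  have hone : #(univ.filter (CanWin m (k + 1) hm hk (N + 1)) \
      univ.filter (CanWin m (k + 1) hm hk N)) ≤ 1 := by omega
  exact card_le_one.1 hone x (by simp [hx, hx']) y (by simp [hy, hy'])

/-- Once the winning positions stabilise, the goal can be forced again from itself. -/
lemma canForce_goalPos_of_stable {N : ℕ}
    (hN : ∀ x, CanWin m (k + 1) hm hk (N + 1) x → CanWin m (k + 1) hm hk N x) :
    CanForce (CanWin m (k + 1) hm hk N) (goalPos m (k + 1) hm) := by
  classical
  have hsub : (Finset.univ.filter (CanForce (CanWin m (k + 1) hm hk N))) ⊆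
      Finset.univ.filter (CanWin m (k + 1) hm hk N) := fun x hx => by
    simp only [Finset.mem_filter, Finset.mem_univ, true_and] at hx ⊢
    exact hN x (Or.inr hx)
  have heq := Finset.eq_of_subset_of_card_le hsub
    ((isLowerAwayFrom_canWin N).card_canForce (le_goalPos_apply 0)).ge
  have hmem : goalPos m (k + 1) hm ∈ Finset.univ.filter (CanWin m (k + 1) hm hk N) := by
    simpa using canWin_goalPos N
  rw [← heq] at hmem
  simpa using hmem

lemma canWin_of_stable {N : ℕ}
    (hN : ∀ x, CanWin m (k + 1) hm hk (N + 1) x → CanWin m (k + 1) hm hk N x)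
    (x : Fin (k + 1) → Fin m) : CanWin m (k + 1) hm hk N x := by
  have force : ∀ y, CanWin m (k + 1) hm hk N y →
      CanForce (CanWin m (k + 1) hm hk N) y := by
    intro y hy
    rcases canWin_succ hy with rfl | h
    · exact canForce_goalPos_of_stable hN
    · exact h
  have move : ∀ y, CanWin m (k + 1) hm hk N y →
      y (Fin.last k) = goalPos m (k + 1) hm (Fin.last k) →
      ∀ c, CanWin m (k + 1) hm hk N (shift c y) := by
    intro y hy hlast c
    obtain ⟨h₁, d, hd, h₂⟩ := force y hy
    rcases lt_or_ge c (y (Fin.last k)) with hc | hc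
    · exact h₁ c hc
    · rw [hlast] at hc hd
      rwa [le_antisymm (le_goalPos_apply _ c) hc, ← le_antisymm (le_goalPos_apply _ d) hd]
  have main : ∀ j ≤ k + 1, ∀ y : Fin (k + 1) → Fin m,
      (∀ i : Fin (k + 1), j ≤ i → y i = goalPos m (k + 1) hm i) →
      CanWin m (k + 1) hm hk N y := by
    intro j
    induction j with
    | zero =>
      intro _ y hy
      rw [funext fun i => hy i (Nat.zero_le _)]
      exact canWin_goalPos N
    | succ j ih =>
      intro hj y hy
      have h := move (Fin.snoc (Fin.tail y) (goalPos m (k + 1) hm (Fin.last k)))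
        (ih (by omega) _ fun i => ?_) (by simp) (y 0)
      · rwa [shift_eq_cons_init, Fin.init_snoc, Fin.cons_self_tail] at h
      · refine Fin.lastCases ?_ (fun i => ?_) i
        · simp
        · intro hi
          rw [Fin.snoc_castSucc]
          exact hy i.succ (by simpa using hi)
  exact main (k + 1) le_rfl x fun i hi => absurd i.isLt (by omega)

/-- The prisoner wins from every position. -/
lemma exists_canWin (x : Fin (k + 1) → Fin m) : ∃ N, CanWin m (k + 1) hm hk N x := by
  obtain ⟨N, hN⟩ := WellFoundedGT.monotone_chain_condition
    (⟨fun N => {x | CanWin m (k + 1) hm hk N x},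
      fun _ _ h _ hx => canWin_mono h hx⟩ : ℕ →o Set (Fin (k + 1) → Fin m))
  refine ⟨N, canWin_of_stable (fun y hy => ?_) x⟩
  have h := hN (N + 1) (Nat.le_succ N)
  exact (Set.ext_iff.1 h y).2 hy

lemma canWin_remoteness (x : Fin (k + 1) → Fin m) :
    CanWin m (k + 1) hm hk (remoteness m (k + 1) hm hk x) x :=
  Nat.sInf_mem (exists_canWin x)

lemma not_canWin_of_lt_remoteness {N : ℕ} {x : Fin (k + 1) → Fin m}
    (h : N < remoteness m (k + 1) hm hk x) : ¬ CanWin m (k + 1) hm hk N x :=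
  Nat.notMem_of_lt_sInf h

/-- Every position of positive remoteness moves to the position of the preceding remoteness. -/
lemma exists_shift_eq_of_remoteness_eq_succ {x y : Fin (k + 1) → Fin m}
    (h : remoteness m (k + 1) hm hk x = remoteness m (k + 1) hm hk y + 1) :
    ∃ c, shift c x = y := by
  have hx := canWin_remoteness (hm := hm) (hk := hk) x
  have hx' : ¬ CanWin m (k + 1) hm hk (remoteness m (k + 1) hm hk y) x :=
    not_canWin_of_lt_remoteness (by omega)
  have hy := canWin_remoteness (hm := hm) (hk := hk) y
  rw [h] at hx
  have hforce := hx.resolve_left fun e => hx' (e ▸ canWin_goalPos _)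
  cases hr : remoteness m (k + 1) hm hk y with
  | zero =>
    rw [hr] at hy hforce
    obtain ⟨-, c, -, hc⟩ := hforce
    exact ⟨c, hc.trans hy.symm⟩
  | succ N =>
    have hy' : ¬ CanWin m (k + 1) hm hk N y := not_canWin_of_lt_remoteness (by omega)
    rw [hr] at hy hforce hx'
    by_contra! hne
    have old : ∀ c, CanWin m (k + 1) hm hk (N + 1) (shift c x) →
        CanWin m (k + 1) hm hk N (shift c x) := fun c hc => by
      by_contra hc'
      exact hne c (eq_of_canWin_succ_of_not_canWin hc hc' hy hy')
    obtain ⟨h₁, c, hc, h₂⟩ := hforce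
    exact hx' (Or.inr ⟨fun d hd => old d (h₁ d hd), c, hc, old c h₂⟩)

end CanWin

/-- Positions of consecutive remoteness overlap: if `r(β) = r(γ) + 1` then the first
`n − 1` coordinates of `β` equal the last `n − 1` coordinates of `γ`, i.e.
`γ_{j+1} = β_j` for all `0 ≤ j ≤ n − 2`. -/
theorem consecutive_remoteness_overlap (m n : ℕ) (hm : 1 ≤ m) (hn : 1 ≤ n)
    (β γ : Fin n → Fin m)
    (h : remoteness m n hm hn β = remoteness m n hm hn γ + 1) :
    ∀ j : ℕ, ∀ hj : j < n - 1, γ ⟨j + 1, by omega⟩ = β ⟨j, by omega⟩ := by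
  obtain ⟨k, rfl⟩ : ∃ k, n = k + 1 := ⟨n - 1, by omega⟩
  obtain ⟨c, rfl⟩ := exists_shift_eq_of_remoteness_eq_succ h
  intro j _
  simp [shift]
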